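/- Let k ≥ 1 and let W ∈ ℝ^{k×k} be the matrix with W_{i,j} = 1 if i ≠ j and W_{i,j} = 0 if i = j. Then there exist matrices L, R ∈ ℝ^{(k+1)×k} such that LᵀR = W and ‖L‖_{1→2}·‖R‖_{1→2} ≤ 2. -/

import Mathlib

/-- `‖A‖_{1→2}`: the maximum Euclidean norm of a column. -/
noncomputable def norm1to2 {ι κ : Type} [Fintype ι] [Fintype κ] (A : Matrix ι κ ℝ) : ℝ :=
  ⨆ j : κ, Real.sqrt (∑ i : ι, (A i j) ^ 2)

/-- If every column of `A` has squared Euclidean norm at most `c`, then `‖A‖_{1→2} ≤ √c`. -/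
theorem norm1to2_le_sqrt {ι κ : Type} [Fintype ι] [Fintype κ] {A : Matrix ι κ ℝ} {c : ℝ}
    (h : ∀ j, ∑ i, (A i j) ^ 2 ≤ c) : norm1to2 A ≤ √c :=
  Real.iSup_le (fun j => Real.sqrt_le_sqrt (h j)) (Real.sqrt_nonneg c)

/-- Factorization of the Gini diversity kernel matrix (`W_{ij} = 1[i ≠ j]`) witnessing
`γ₂(W) ≤ 2`. -/
theorem gini_kernel_factorization (k : ℕ) (hk : 1 ≤ k) :
    ∃ L R : Matrix (Fin (k + 1)) (Fin k) ℝ,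
      L.transpose * R = Matrix.of (fun i j : Fin k => if i = j then (0 : ℝ) else 1) ∧
        norm1to2 L * norm1to2 R ≤ 2 := by
  refine ⟨Matrix.of fun i j => (Fin.cons 1 (Pi.single j 1) : Fin (k + 1) → ℝ) i,
    Matrix.of fun i j => (Fin.cons 1 (Pi.single j (-1)) : Fin (k + 1) → ℝ) i, ?_, ?_⟩
  · ext i j
    by_cases h : i = j <;>
      simp [Matrix.mul_apply, Fin.sum_univ_succ, Pi.single_apply, h, eq_comm]
  · calc
      _ ≤ √2 * √2 := by
        refine mul_le_mul (norm1to2_le_sqrt fun j => ?_) (norm1to2_le_sqrt fun j => ?_)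
          (Real.iSup_nonneg fun j => Real.sqrt_nonneg _) (Real.sqrt_nonneg _) <;>
        norm_num [Fin.sum_univ_succ, Pi.single_apply]
      _ = 2 := Real.mul_self_sqrt zero_le_two
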